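/- Let d be a positive integer, L > 0, σ > 0, let U ⊆ ℝ^d be a measurable set with 0 < vol(U) < ∞, let f* : ℝ^d → [-1,1] be L-Lipschitz with respect to the Euclidean norm, and let h : ℝ^d → ℝ be measurable with |h(x)| ≤ 1 for all x. Assume h(x) = 0 and f*(x) = 0 for all x ∉ U. Then the Gaussian smoothing h̃ satisfies ℓ_1(h̃, f*) ≤ ℓ_1(h, f*) + 2Lσ√d. -/

import Mathlib

open MeasureTheory

/-- Density of the centered Gaussian on `ℝ^d` with covariance `σ² I_d`. -/
noncomputable def gaussDensity (d : ℕ) (σ : ℝ) (t : EuclideanSpace ℝ (Fin d)) : ℝ :=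
  (2 * Real.pi * σ ^ 2) ^ (-(d : ℝ) / 2) * Real.exp (-‖t‖ ^ 2 / (2 * σ ^ 2))

/-- Gaussian smoothing `h̃(x) = ∫ h(x+t) φ_σ(t) dt`. -/
noncomputable def gaussSmooth (d : ℕ) (σ : ℝ)
    (h : EuclideanSpace ℝ (Fin d) → ℝ) (x : EuclideanSpace ℝ (Fin d)) : ℝ :=
  ∫ t : EuclideanSpace ℝ (Fin d), h (x + t) * gaussDensity d σ t

/-- `ℓ₁` distance between two functions relative to the uniform distribution on `U`. -/
noncomputable def l1Dist (d : ℕ) (U : Set (EuclideanSpace ℝ (Fin d)))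
    (f g : EuclideanSpace ℝ (Fin d) → ℝ) : ℝ :=
  (1 / (volume U).toReal) * ∫ x in U, |f x - g x|

theorem aux_gd_nonneg (d : ℕ) (σ : ℝ) (t : EuclideanSpace ℝ (Fin d)) : 0 ≤ gaussDensity d σ t := by
  unfold gaussDensity; positivity

theorem aux_int_exp (d : ℕ) (b : ℝ) (hb : 0 < b) :
    Integrable (fun t : EuclideanSpace ℝ (Fin d) => Real.exp (-b * ‖t‖ ^ 2)) ∧
    ∫ t : EuclideanSpace ℝ (Fin d), Real.exp (-b * ‖t‖ ^ 2) = (Real.pi / b) ^ ((d : ℝ) / 2) := by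
  have h2 := GaussianFourier.integral_rexp_neg_mul_sq_norm (V := EuclideanSpace ℝ (Fin d)) hb
  rw [finrank_euclideanSpace_fin] at h2
  refine ⟨?_, h2⟩
  by_contra hn
  rw [integral_undef hn] at h2
  have : 0 < (Real.pi / b) ^ ((d : ℝ) / 2) := by positivity
  linarith

theorem aux_gd_exp (d : ℕ) (σ c : ℝ) (hσ : 0 < σ) (hc : c < 1) :
    Integrable (fun t : EuclideanSpace ℝ (Fin d) =>
      Real.exp (c * ‖t‖ ^ 2 / (2 * σ ^ 2)) * gaussDensity d σ t) ∧
    ∫ t : EuclideanSpace ℝ (Fin d), Real.exp (c * ‖t‖ ^ 2 / (2 * σ ^ 2)) * gaussDensity d σ t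
      = (1 - c) ^ (-(d : ℝ) / 2) := by
  have hc' : 0 < 1 - c := by linarith
  obtain ⟨h1, h2⟩ := aux_int_exp d ((1 - c) / (2 * σ ^ 2)) (by positivity)
  have e : (fun t : EuclideanSpace ℝ (Fin d) =>
      Real.exp (c * ‖t‖ ^ 2 / (2 * σ ^ 2)) * gaussDensity d σ t) =
      fun t => (2 * Real.pi * σ ^ 2) ^ (-(d : ℝ) / 2) *
        Real.exp (-((1 - c) / (2 * σ ^ 2)) * ‖t‖ ^ 2) := by
    funext t
    unfold gaussDensity
    rw [mul_left_comm, ← Real.exp_add]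
    congr 2
    ring
  rw [e]
  refine ⟨h1.const_mul _, ?_⟩
  rw [integral_const_mul, h2]
  have : Real.pi / ((1 - c) / (2 * σ ^ 2)) = (2 * Real.pi * σ ^ 2) * (1 - c)⁻¹ := by
    field_simp
  rw [this, Real.mul_rpow (x := 2 * Real.pi * σ ^ 2) (y := (1 - c)⁻¹) (by positivity) (by positivity), ← mul_assoc,
    ← Real.rpow_add (by positivity), Real.inv_rpow hc'.le, ← Real.rpow_neg hc'.le]
  have : -(d : ℝ) / 2 + d / 2 = 0 := by ring
  rw [this, Real.rpow_zero, one_mul]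
  congr 1
  ring

theorem aux_gd (d : ℕ) (σ : ℝ) (hσ : 0 < σ) :
    Integrable (gaussDensity d σ) ∧ ∫ t, gaussDensity d σ t = 1 := by
  have := aux_gd_exp d σ 0 hσ (by norm_num)
  simpa using this

theorem aux_moment (d : ℕ) (hd : 0 < d) (σ : ℝ) (hσ : 0 < σ) :
    Integrable (fun t : EuclideanSpace ℝ (Fin d) => ‖t‖ * gaussDensity d σ t) ∧
    ∫ t : EuclideanSpace ℝ (Fin d), ‖t‖ * gaussDensity d σ t ≤ 2 * σ * Real.sqrt d := by
  have hd1 : (1 : ℝ) ≤ d := by exact_mod_cast hd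
  have hd0 : (0 : ℝ) < d := by linarith
  set c : ℝ := 1 / (2 * d) with hcdef
  have hc0 : 0 < c := by positivity
  have hc2 : c ≤ 1 / 2 := by
    rw [hcdef]; apply one_div_le_one_div_of_le <;> linarith
  obtain ⟨h1, h2⟩ := aux_gd_exp d σ c hσ (by linarith)
  obtain ⟨g1, g2⟩ := aux_gd d σ hσ
  set s := σ * Real.sqrt d with hs
  have hs0 : 0 < s := by positivity
  have hss : s ^ 2 = σ ^ 2 * d := by rw [hs, mul_pow, Real.sq_sqrt hd0.le]
  set G : EuclideanSpace ℝ (Fin d) → ℝ := fun t =>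
    2 * s * (Real.exp (c * ‖t‖ ^ 2 / (2 * σ ^ 2)) * gaussDensity d σ t)
      - 3 / 2 * s * gaussDensity d σ t with hG
  have hGi : Integrable G := (h1.const_mul _).sub (g1.const_mul _)
  have hpt : ∀ t : EuclideanSpace ℝ (Fin d), ‖t‖ * gaussDensity d σ t ≤ G t := by
    intro t
    have e1 := Real.add_one_le_exp (c * ‖t‖ ^ 2 / (2 * σ ^ 2))
    have e2 : c * ‖t‖ ^ 2 / (2 * σ ^ 2) = ‖t‖ ^ 2 / (4 * s ^ 2) := by
      rw [hss, hcdef]; field_simp; ring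
    have e3 : ‖t‖ ≤ s / 2 + 2 * s * (‖t‖ ^ 2 / (4 * s ^ 2)) := by
      have : s / 2 + 2 * s * (‖t‖ ^ 2 / (4 * s ^ 2)) - ‖t‖ = (s - ‖t‖) ^ 2 / (2 * s) := by
        field_simp; ring
      have : 0 ≤ (s - ‖t‖) ^ 2 / (2 * s) := by positivity
      linarith
    have e4 : ‖t‖ ≤ 2 * s * Real.exp (c * ‖t‖ ^ 2 / (2 * σ ^ 2)) - 3 / 2 * s := by
      rw [← e2] at e3
      nlinarith
    have := mul_le_mul_of_nonneg_right e4 (aux_gd_nonneg d σ t)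
    simp only [hG]
    linarith
  have hint : Integrable (fun t : EuclideanSpace ℝ (Fin d) => ‖t‖ * gaussDensity d σ t) := by
    refine hGi.mono' ?_ (Filter.Eventually.of_forall fun t => ?_)
    · exact continuous_norm.aestronglyMeasurable.mul g1.aestronglyMeasurable
    · rw [Real.norm_of_nonneg (mul_nonneg (norm_nonneg _) (aux_gd_nonneg d σ t))]
      exact hpt t
  refine ⟨hint, ?_⟩
  have hle := integral_mono hint hGi hpt
  have hGv : ∫ t, G t = 2 * s * (1 - c) ^ (-(d : ℝ) / 2) - 3 / 2 * s := by
    simp only [hG]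
    rw [integral_sub (h1.const_mul _) (g1.const_mul _), integral_const_mul, integral_const_mul,
      h2, g2, mul_one]
  have hb : (1 - c) ^ (-(d : ℝ) / 2) ≤ 3 / 2 := by
    have hB := one_add_mul_le_pow (a := -c) (by linarith) d
    have hdc : (d : ℝ) * -c = -(1 / 2) := by rw [hcdef]; field_simp
    rw [hdc, ← sub_eq_add_neg 1 c] at hB
    have hp : 0 ≤ (1 - c) ^ (-(d : ℝ) / 2) := Real.rpow_nonneg (by linarith) _
    have hsq : ((1 - c) ^ (-(d : ℝ) / 2)) ^ 2 * (1 - c) ^ d = 1 := by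
      rw [← Real.rpow_natCast ((1 - c) ^ (-(d : ℝ) / 2)) 2, ← Real.rpow_mul (by linarith),
        ← Real.rpow_natCast (1 - c) d, ← Real.rpow_add (by linarith)]
      have : -(d : ℝ) / 2 * ((2 : ℕ) : ℝ) + d = 0 := by push_cast; ring
      rw [this, Real.rpow_zero]
    by_contra hcon
    push Not at hcon
    nlinarith [sq_nonneg ((1 - c) ^ (-(d : ℝ) / 2))]
  rw [hGv] at hle
  nlinarith

/-- If `f*` is `L`-Lipschitz with values in `[-1,1]`, `h` is measurable
with `|h| ≤ 1`, both vanish off a set `U` of finite positive volume, then the Gaussian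
smoothing `h̃` of `h` satisfies `ℓ₁(h̃, f*) ≤ ℓ₁(h, f*) + 2Lσ√d`. -/
theorem gaussSmooth_close_to_ground_truth
    (d : ℕ) (hd : 0 < d) (L σ : ℝ) (hL : 0 < L) (hσ : 0 < σ)
    (U : Set (EuclideanSpace ℝ (Fin d))) (hU : MeasurableSet U)
    (hUpos : 0 < volume U) (hUfin : volume U < ⊤)
    (fstar : EuclideanSpace ℝ (Fin d) → ℝ)
    (hfrange : ∀ x, fstar x ∈ Set.Icc (-1 : ℝ) 1)
    (hfLip : ∀ x y, |fstar x - fstar y| ≤ L * ‖x - y‖)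
    (h : EuclideanSpace ℝ (Fin d) → ℝ)
    (hmeas : Measurable h) (hbd : ∀ x, |h x| ≤ 1)
    (hvanish : ∀ x, x ∉ U → h x = 0 ∧ fstar x = 0) :
    l1Dist d U (gaussSmooth d σ h) fstar ≤
      l1Dist d U h fstar + 2 * L * σ * Real.sqrt d := by
  obtain ⟨g1, g2⟩ := aux_gd d σ hσ
  obtain ⟨m1, m2⟩ := aux_moment d hd σ hσ
  have hfc : Continuous fstar := by
    have : LipschitzWith L.toNNReal fstar := by
      refine LipschitzWith.of_dist_le_mul fun x y => ?_
      rw [Real.dist_eq, dist_eq_norm, Real.coe_toNNReal _ hL.le]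
      exact hfLip x y
    exact this.continuous
  set g : EuclideanSpace ℝ (Fin d) → ℝ := fun x => |h x - fstar x| with hg
  have hgm : Measurable g := (hmeas.sub hfc.measurable).abs
  have hg0 : ∀ x, 0 ≤ g x := fun x => abs_nonneg _
  have hfb : ∀ x, |fstar x| ≤ 1 := fun x => abs_le.2 (hfrange x)
  have hg2 : ∀ x, g x ≤ 2 := fun x => by
    have := abs_sub (h x) (fstar x)
    have := hbd x
    have := hfb x
    simp only [hg]; linarith
  have hgU : ∀ x, x ∉ U → g x = 0 := fun x hx => by
    simp [hg, (hvanish x hx).1, (hvanish x hx).2]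
  have : IsFiniteMeasure (volume.restrict U) := ⟨by simpa using hUfin⟩
  have hgiU : IntegrableOn g U := by
    refine (integrable_const (2 : ℝ)).mono' hgm.aestronglyMeasurable
      (Filter.Eventually.of_forall fun x => ?_)
    rw [Real.norm_of_nonneg (hg0 x)]; exact hg2 x
  have hgi : Integrable g := by
    rw [← integrableOn_iff_integrable_of_support_subset (s := U)]
    · exact hgiU
    · intro x hx
      by_contra hxU
      exact hx (hgU x hxU)
  have hgeq : ∫ x in U, g x = ∫ x, g x := setIntegral_eq_integral_of_forall_compl_eq_zero hgU
  -- bounded measurable functions times the density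
  have hbi : ∀ (k : EuclideanSpace ℝ (Fin d) → ℝ) (C : ℝ), Measurable k → (∀ x, |k x| ≤ C) →
      Integrable (fun t => k t * gaussDensity d σ t) := by
    intro k C hk hkC
    exact g1.bdd_mul hk.aestronglyMeasurable (Filter.Eventually.of_forall hkC)
  set M := ∫ t : EuclideanSpace ℝ (Fin d), ‖t‖ * gaussDensity d σ t with hM
  have hpt : ∀ x, |gaussSmooth d σ h x - fstar x| ≤
      (∫ t, g (x + t) * gaussDensity d σ t) + L * M := by
    intro x
    have i1 : Integrable (fun t => h (x + t) * gaussDensity d σ t) :=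
      hbi (fun t => h (x + t)) 1 (hmeas.comp (measurable_const_add x)) fun t => hbd _
    have i2 : Integrable (fun t => g (x + t) * gaussDensity d σ t) :=
      hbi (fun t => g (x + t)) 2 (hgm.comp (measurable_const_add x)) fun t => by
        rw [abs_of_nonneg (hg0 _)]; exact hg2 _
    have e1 : gaussSmooth d σ h x - fstar x =
        ∫ t, (h (x + t) * gaussDensity d σ t - fstar x * gaussDensity d σ t) := by
      rw [integral_sub i1 (g1.const_mul _), integral_const_mul, g2, mul_one]
      rfl
    rw [e1, hM, ← integral_const_mul, ← integral_add i2 (m1.const_mul L)]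
    refine (abs_integral_le_integral_abs).trans ?_
    refine integral_mono (i1.sub (g1.const_mul _)).abs (i2.add (m1.const_mul L)) fun t => ?_
    have hd0 := aux_gd_nonneg d σ t
    have a1 : |h (x + t) - fstar x| ≤ g (x + t) + L * ‖t‖ := by
      have := abs_sub_le (h (x + t)) (fstar (x + t)) (fstar x)
      have h3 := hfLip (x + t) x
      rw [add_sub_cancel_left] at h3
      simp only [hg]; linarith
    have a2 := mul_le_mul_of_nonneg_right a1 hd0
    show |h (x + t) * gaussDensity d σ t - fstar x * gaussDensity d σ t| ≤
      g (x + t) * gaussDensity d σ t + L * (‖t‖ * gaussDensity d σ t)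
    rw [← sub_mul, abs_mul, abs_of_nonneg hd0]
    linarith
  have hF : Integrable (Function.uncurry fun x t => g (x + t) * gaussDensity d σ t)
      ((volume.restrict U).prod volume) := by
    have hdom : Integrable (fun z : EuclideanSpace ℝ (Fin d) × EuclideanSpace ℝ (Fin d) =>
        (2 : ℝ) * gaussDensity d σ z.2) ((volume.restrict U).prod volume) :=
      (integrable_const (2 : ℝ)).mul_prod g1
    refine hdom.mono' ?_ (Filter.Eventually.of_forall fun z => ?_)
    · have : Measurable (gaussDensity d σ) := by unfold gaussDensity; fun_prop
      exact ((hgm.comp (measurable_fst.add measurable_snd)).mul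
        (this.comp measurable_snd)).aestronglyMeasurable
    · have hd0 := aux_gd_nonneg d σ z.2
      simp only [Function.uncurry]
      rw [Real.norm_of_nonneg (mul_nonneg (hg0 _) hd0)]
      exact mul_le_mul_of_nonneg_right (hg2 _) hd0
  have hFub : ∫ x in U, ∫ t, g (x + t) * gaussDensity d σ t ≤ ∫ x in U, g x := by
    rw [integral_integral_swap hF]
    have : ∫ t, (∫ x in U, g x) * gaussDensity d σ t = ∫ x in U, g x := by
      rw [integral_const_mul, g2, mul_one]
    rw [← this]
    refine integral_mono hF.integral_prod_right (g1.const_mul _) fun t => ?_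
    show ∫ x in U, g (x + t) * gaussDensity d σ t ≤ _
    rw [integral_mul_const]
    refine mul_le_mul_of_nonneg_right ?_ (aux_gd_nonneg d σ t)
    rw [hgeq, ← integral_add_right_eq_self g t]
    exact setIntegral_le_integral (hgi.comp_add_right t) (Filter.Eventually.of_forall fun x => hg0 _)
  have hV : 0 < (volume U).toReal := ENNReal.toReal_pos hUpos.ne' hUfin.ne
  have hmain : ∫ x in U, |gaussSmooth d σ h x - fstar x| ≤
      (∫ x in U, g x) + (volume U).toReal * (L * M) := by
    have hi : Integrable (fun x => ∫ t, g (x + t) * gaussDensity d σ t) (volume.restrict U) :=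
      hF.integral_prod_left
    refine (integral_mono_of_nonneg (Filter.Eventually.of_forall fun x => abs_nonneg _)
      (hi.add (integrable_const (L * M))) (Filter.Eventually.of_forall hpt)).trans ?_
    have : ∫ x in U, ((∫ t, g (x + t) * gaussDensity d σ t) + L * M) =
        (∫ x in U, ∫ t, g (x + t) * gaussDensity d σ t) + (volume U).toReal * (L * M) := by
      rw [integral_add hi (integrable_const _), setIntegral_const]
      simp [Measure.real]
    refine le_trans (le_of_eq this) ?_
    linarith
  unfold l1Dist
  have h5 := mul_le_mul_of_nonneg_left hmain (one_div_pos.2 hV).le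
  have h6 : 1 / (volume U).toReal * ((∫ x in U, g x) + (volume U).toReal * (L * M)) =
      1 / (volume U).toReal * (∫ x in U, g x) + L * M := by
    field_simp
  have h7 := mul_le_mul_of_nonneg_left m2 hL.le
  rw [h6] at h5
  linarith
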